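/- Let d ∈ ℕ, T ≥ 2, μ ∈ P(ℝ^{dT}), a ∈ [0,1), b > 0, c > 0 and r ≥ 0. Then there exists C > 0 such that for all t = 1,…,T−1 and all N ∈ ℕ: (uniform grid) Σ_{G ∈ \hatΦ^N_t} (‖G‖^r + 1)^b (diam(G) + 1)^c μ(G)^{1−a} ≤ C N^{ta/T} Σ_{j≥0} 2^{j(rb + dta)} μ(A^t_j)^{1−a}, and (non-uniform grid) Σ_{G ∈ \checkΦ^N_t} (‖G‖^r + 1)^b (diam(G) + 1)^c μ(G)^{1−a} ≤ C N^{ta/T} Σ_{j≥0} 2^{j(rb + c)} μ(A^t_j)^{1−a}. -/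

import Mathlib

open MeasureTheory ProbabilityTheory Filter Set
open scoped ENNReal NNReal Topology Classical

noncomputable section

namespace AWPaper

/-- The state space `ℝ^d` with Euclidean norm. -/
abbrev E (d : ℕ) := EuclideanSpace ℝ (Fin d)

/-- Paths of length `t` with values in `ℝ^d`. -/
abbrev PathT (d t : ℕ) := Fin t → E d

/-- Sum-norm `‖x‖ = ∑_t ‖x_t‖` of a (partial) path. -/
def sumNorm {d t : ℕ} (a : PathT d t) : ℝ := ∑ s, ‖a s‖

/-- Sum-distance `∑_t ‖x_t - y_t‖` of two (partial) paths. -/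
def sumDist {d t : ℕ} (a b : PathT d t) : ℝ := ∑ s, ‖a s - b s‖

/-- Couplings of two measures. -/
def Cpl {α β : Type*} [MeasurableSpace α] [MeasurableSpace β]
    (μ : Measure α) (ν : Measure β) : Set (Measure (α × β)) :=
  {π | π.map Prod.fst = μ ∧ π.map Prod.snd = ν}

/-- First order Wasserstein distance (with value in `ℝ≥0∞`). -/
def W1 {α : Type*} [MeasurableSpace α] [PseudoEMetricSpace α]
    (μ ν : Measure α) : ℝ≥0∞ :=
  ⨅ π ∈ Cpl μ ν, ∫⁻ p, edist p.1 p.2 ∂π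

/-- Restriction of a path to its first `t` coordinates. -/
def restr (d T : ℕ) {t : ℕ} (h : t ≤ T) : PathT d T → PathT d t :=
  fun x i => x (Fin.castLE h i)

/-- The pair (first `t` coordinates, coordinate `t`); used for disintegration. -/
def frontMap (d T : ℕ) {t : ℕ} (ht : t < T) : PathT d T → PathT d t × E d :=
  fun x => (restr d T ht.le x, x ⟨t, ht⟩)

/-- Totalized version of `Measure.condKernel` (zero measure if the joint measure is not
finite). -/
def condKerTotal {α Ω : Type*} [MeasurableSpace α] [MeasurableSpace Ω]
    [StandardBorelSpace Ω] [Nonempty Ω] (ρ : Measure (α × Ω)) : α → Measure Ω :=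
  if h : IsFiniteMeasure ρ then fun a => (@Measure.condKernel α Ω _ _ _ _ ρ h) a
  else fun _ => 0

/-- The (canonical) kernel `μ_{x_{1:t}}` of `μ`: the disintegration of the law of the
`(t+1)`-st coordinate given the first `t` coordinates. -/
def muKer {d T : ℕ} (μ : Measure (PathT d T)) {t : ℕ} (ht : t < T) :
    PathT d t → Measure (E d) :=
  condKerTotal (μ.map (frontMap d T ht))

/-- Joint restriction map for couplings. -/
def pairFront (d T : ℕ) {t : ℕ} (ht : t < T) :
    PathT d T × PathT d T → (PathT d t × PathT d t) × (E d × E d) :=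
  fun p => ((restr d T ht.le p.1, restr d T ht.le p.2), (p.1 ⟨t, ht⟩, p.2 ⟨t, ht⟩))

/-- A coupling `π` of `μ` and `ν` is bi-causal if for each `t = 1,…,T-1` the disintegration
of `π` given the first `t` coordinates of both paths is (a.e.) a coupling of the
corresponding kernels of `μ` and `ν`. -/
def Bicausal {d T : ℕ} (μ ν : Measure (PathT d T))
    (π : Measure (PathT d T × PathT d T)) : Prop :=
  π ∈ Cpl μ ν ∧
  ∀ (t : ℕ) (ht : t < T), 1 ≤ t →
    ∀ᵐ ab ∂(π.map (fun p => (restr d T ht.le p.1, restr d T ht.le p.2))),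
      condKerTotal (π.map (pairFront d T ht)) ab ∈ Cpl (muKer μ ht ab.1) (muKer ν ht ab.2)

/-- The (first order) adapted Wasserstein distance. -/
def AW {d T : ℕ} (μ ν : Measure (PathT d T)) : ℝ≥0∞ :=
  ⨅ π ∈ {π | Bicausal μ ν π}, ∫⁻ p, (∑ t, edist (p.1 t) (p.2 t)) ∂π

/-- Empirical measure of the first `N` elements of a sequence of samples. -/
def emp {α : Type*} [MeasurableSpace α] (x : ℕ → α) (N : ℕ) : Measure α :=
  (N : ℝ≥0∞)⁻¹ • ∑ n ∈ Finset.range N, Measure.dirac (x n)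

/-- Empirical measure of a finite family of samples. -/
def empFin {α : Type*} [MeasurableSpace α] {k : ℕ} (y : Fin k → α) : Measure α :=
  (k : ℝ≥0∞)⁻¹ • ∑ i, Measure.dirac (y i)

/-- The grid size `Δ_N = N^{-1/(dT)}`. -/
def ΔN (d T N : ℕ) : ℝ := (N : ℝ) ^ (-(1 : ℝ) / (d * T))

/-- `m = ⌈1/Δ_N⌉`. -/
def mOf (d T N : ℕ) : ℕ := ⌈(1 : ℝ) / ΔN d T N⌉₊

/-- Midpoint of the grid cube of side length `s` containing `u`. -/
def gridPt (s u : ℝ) : ℝ := (⌊u / s⌋ + 2⁻¹) * s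

/-- Projection of a path onto the midpoints of the uniform grid of side `1/m`,
`m = ⌈N^{1/(dT)}⌉`. -/
def unifProj (d T N : ℕ) : PathT d T → PathT d T :=
  fun x t => (WithLp.equiv 2 (Fin d → ℝ)).symm
    (fun i => gridPt ((mOf d T N : ℝ))⁻¹ (x t i))

/-- The sup-norm over all real coordinates of a (partial) path. -/
def supA {d t : ℕ} (a : PathT d t) : ℝ≥0 :=
  Finset.univ.sup (fun p : Fin t × Fin d => ‖a p.1 p.2‖₊)

lemma ringIdx_ex {d t : ℕ} (a : PathT d t) : ∃ j : ℕ, supA a ≤ 2 ^ j :=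
  (pow_unbounded_of_one_lt (supA a) one_lt_two).imp fun _ h => h.le

/-- The index of the cubic ring `A_j` containing a given point: the least `j` with
`‖a‖_∞ ≤ 2^j`. -/
def ringIdx {d t : ℕ} (a : PathT d t) : ℕ := Nat.find (ringIdx_ex a)

/-- The cubic ring `A^t_j` (points whose ring index is `j`). -/
def ringSet (d t : ℕ) (j : ℕ) : Set (PathT d t) := {a | ringIdx a = j}

/-- Side length `2^{j-1}/m` of the cubes of the non-uniform grid inside the ring `A_j`. -/
def sideLen (m j : ℕ) : ℝ := (2 : ℝ) ^ ((j : ℤ) - 1) / m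

/-- Projection of a path onto the midpoints of the non-uniform grid. -/
def nonUnifProj (d T N : ℕ) : PathT d T → PathT d T :=
  fun x t => (WithLp.equiv 2 (Fin d → ℝ)).symm
    (fun i => gridPt (sideLen (mOf d T N) (ringIdx x)) (x t i))

/-- Index set for the cubes of the uniform grid on `ℝ^{dt}`. -/
abbrev Idx (d t : ℕ) := Fin t → Fin d → ℤ

/-- Cube of the uniform grid of side `1/m` on `ℝ^{dt}`. -/
def unifCell (d t m : ℕ) (z : Idx d t) : Set (PathT d t) :=
  {a | ∀ s i, ⌊a s i * m⌋ = z s i}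

/-- Cube of the non-uniform grid, inside the ring `A^t_j`. -/
def nonUnifCell (d t m : ℕ) (j : ℕ) (z : Idx d t) : Set (PathT d t) :=
  {a | ringIdx a = j ∧ ∀ s i, ⌊a s i / sideLen m j⌋ = z s i}

/-- The cubes of the uniform grid. -/
def unifCells (d t m : ℕ) : Set (Set (PathT d t)) := Set.range (unifCell d t m)

/-- The cubes of the non-uniform grid. -/
def nonUnifCells (d t m : ℕ) : Set (Set (PathT d t)) :=
  Set.range (fun p : ℕ × Idx d t => nonUnifCell d t m p.1 p.2)

/-- Mass given by (the up-to-time-`t` marginal of) `ρ` to a set `G ⊆ ℝ^{dt}`. -/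
def cellMass {d T : ℕ} (ρ : Measure (PathT d T)) {t : ℕ} (h : t ≤ T)
    (G : Set (PathT d t)) : ℝ≥0∞ :=
  ρ (restr d T h ⁻¹' G)

/-- The average kernel `μ_G` of `μ` on `G`:
`μ_G(B) = μ(X_{1:t} ∈ G, X_{t+1} ∈ B)/μ(X_{1:t} ∈ G)`, and `δ_0` if `μ(X_{1:t} ∈ G) = 0`. -/
def avgKer {d T : ℕ} (μ : Measure (PathT d T)) {t : ℕ} (ht : t < T)
    (G : Set (PathT d t)) : Measure (E d) :=
  if μ (restr d T ht.le ⁻¹' G) = 0 then Measure.dirac 0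
  else (μ (restr d T ht.le ⁻¹' G))⁻¹ •
    ((μ.restrict (restr d T ht.le ⁻¹' G)).map (fun x => x ⟨t, ht⟩))

/-- `‖G‖ = sup_{x ∈ G} ‖x‖` (sum-norm), with value in `ℝ≥0∞`. -/
def cellNorm {d t : ℕ} (G : Set (PathT d t)) : ℝ≥0∞ :=
  ⨆ a ∈ G, ∑ s, (‖a s‖₊ : ℝ≥0∞)

/-- `diam(G) = sup_{x,y ∈ G} ‖x - y‖` (sum-norm), with value in `ℝ≥0∞`. -/
def cellDiam {d t : ℕ} (G : Set (PathT d t)) : ℝ≥0∞ :=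
  ⨆ a ∈ G, ⨆ b ∈ G, ∑ s, edist (a s) (b s)

/-- `p`-th moment `M_p(ρ) = ∫ ‖y‖^p dρ` of a measure on `ℝ^d`. -/
def Mp {d : ℕ} (p : ℝ) (ρ : Measure (E d)) : ℝ≥0∞ :=
  ∫⁻ y, (‖y‖₊ : ℝ≥0∞) ^ p ∂ρ

/-- `(α,γ)`-exponential moment `E_{α,γ}(ρ) = ∫ exp(γ‖y‖^α) dρ` of a measure on `ℝ^d`. -/
def ExpM {d : ℕ} (α γ : ℝ) (ρ : Measure (E d)) : ℝ≥0∞ :=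
  ∫⁻ y, ENNReal.ofReal (Real.exp (γ * ‖y‖ ^ α)) ∂ρ

/-- `q`-th moment of a measure on path space (with the sum-norm). -/
def pathMom {d T : ℕ} (q : ℝ) (μ : Measure (PathT d T)) : ℝ≥0∞ :=
  ∫⁻ x, (ENNReal.ofReal (sumNorm x)) ^ q ∂μ

/-- `K` is a disintegration (kernel family) of the `(t+1)`-st coordinate of `μ` given the
first `t` coordinates. -/
def IsDisint {d T : ℕ} (μ : Measure (PathT d T)) {t : ℕ} (ht : t < T)
    (K : PathT d t → Measure (E d)) : Prop :=
  (∀ a, IsProbabilityMeasure (K a)) ∧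
  (∀ B : Set (E d), MeasurableSet B → Measurable fun a => K a B) ∧
  ∀ (A : Set (PathT d t)) (B : Set (E d)), MeasurableSet A → MeasurableSet B →
    μ ((restr d T ht.le ⁻¹' A) ∩ ((fun x => x ⟨t, ht⟩) ⁻¹' B))
      = ∫⁻ a in A, K a B ∂(μ.map (restr d T ht.le))

/-- `μ` has `L`-Lipschitz kernels: some disintegration is `L`-Lipschitz w.r.t. the
Wasserstein distance. -/
def HasLipKernels (d T : ℕ) (L : ℝ) (μ : Measure (PathT d T)) : Prop :=
  ∃ K : (t : ℕ) → t < T → PathT d t → Measure (E d),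
    ∀ (t : ℕ) (ht : t < T), 1 ≤ t → IsDisint μ ht (K t ht) ∧
      ∀ a b, W1 (K t ht a) (K t ht b) ≤ ENNReal.ofReal (L * sumDist a b)

/-- The noise-kernel decomposition data of a measure `μ` on path space:
kernels `K`, functions `f_t`, `σ_t` and noise laws `λ_{x_{1:t}}` with
`μ_{x_{1:t}} = law of f_t(x_{1:t}) + σ_t(x_{1:t})·ε`, `ε ∼ λ_{x_{1:t}}`. -/
structure KernelData (d T : ℕ) (μ : Measure (PathT d T)) where
  K : (t : ℕ) → t < T → PathT d t → Measure (E d)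
  f : (t : ℕ) → t < T → PathT d t → E d
  sig : (t : ℕ) → t < T → PathT d t → ℝ
  lam : (t : ℕ) → t < T → PathT d t → Measure (E d)
  disint : ∀ (t : ℕ) (ht : t < T), 1 ≤ t → IsDisint μ ht (K t ht)
  lamProb : ∀ (t : ℕ) (ht : t < T) (a : PathT d t), IsProbabilityMeasure (lam t ht a)
  sigNonneg : ∀ (t : ℕ) (ht : t < T) (a : PathT d t), 0 ≤ sig t ht a
  decomp : ∀ (t : ℕ) (ht : t < T) (a : PathT d t), 1 ≤ t →
    K t ht a = (lam t ht a).map (fun e => f t ht a + sig t ht a • e)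

/-- The kernels are `L`-Lipschitz w.r.t. the Wasserstein distance. -/
def KernelData.Lip {d T : ℕ} {μ : Measure (PathT d T)} (κ : KernelData d T μ)
    (L : ℝ) : Prop :=
  ∀ (t : ℕ) (ht : t < T), 1 ≤ t → ∀ a b,
    W1 (κ.K t ht a) (κ.K t ht b) ≤ ENNReal.ofReal (L * sumDist a b)

/-- Growth condition `σ_t(x_{1:t}) ≤ c ‖x_{1:t}‖^r`. -/
def KernelData.Growth {d T : ℕ} {μ : Measure (PathT d T)} (κ : KernelData d T μ)
    (c r : ℝ) : Prop :=
  ∀ (t : ℕ) (ht : t < T) (a : PathT d t), 1 ≤ t → κ.sig t ht a ≤ c * sumNorm a ^ r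

/-- The functions `f_t` are `L_f`-Lipschitz. -/
def KernelData.fLip {d T : ℕ} {μ : Measure (PathT d T)} (κ : KernelData d T μ)
    (Lf : ℝ) : Prop :=
  ∀ (t : ℕ) (ht : t < T), 1 ≤ t → ∀ a b,
    ‖κ.f t ht a - κ.f t ht b‖ ≤ Lf * sumDist a b

/-- `D(d) = d+1` for `d ∈ {1,2}` and `D(d) = d` for `d ≥ 3`. -/
def Dd (d : ℕ) : ℝ := if d ≤ 2 then (d : ℝ) + 1 else (d : ℝ)

/-- Common part of Settings 1 and 2. -/
structure SettingBase (d T : ℕ) (r p L Lf : ℝ) (μ : Measure (PathT d T))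
    (κ : KernelData d T μ) : Prop where
  hd : 0 < d
  hT : 2 ≤ T
  hr : 0 ≤ r
  hp : 1 ≤ p
  hLf : 0 < Lf
  hprob : IsProbabilityMeasure μ
  hLip : κ.Lip L
  hgrow : ∃ c : ℝ, 0 < c ∧ κ.Growth c r
  hfLip : κ.fLip Lf
  hmom : ∃ M : ℝ≥0∞, M ≠ ⊤ ∧ ∀ (t : ℕ) (ht : t < T), 1 ≤ t → ∀ a, Mp p (κ.lam t ht a) ≤ M

/-- Setting 1. -/
def Setting1 (d T : ℕ) (r p q L Lf : ℝ) (μ : Measure (PathT d T))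
    (κ : KernelData d T μ) : Prop :=
  SettingBase d T r p L Lf μ κ ∧
  max ((Dd d / (Dd d - 1)) * (r + T - 1)) (r * p + Dd d * (T - 1) * (p - 1)) < q ∧
  pathMom q μ < ⊤

/-- Setting 2. -/
def Setting2 (d T : ℕ) (r p q L Lf : ℝ) (μ : Measure (PathT d T))
    (κ : KernelData d T μ) : Prop :=
  SettingBase d T r p L Lf μ κ ∧
  max (r * Dd d / (Dd d - 1)) ((r + 1) * p) < q ∧
  pathMom q μ < ⊤

/-- Setting 3. -/
structure Setting3 (d T : ℕ) (r α γ L Lf : ℝ) (μ : Measure (PathT d T))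
    (κ : KernelData d T μ) : Prop where
  hd : 0 < d
  hT : 2 ≤ T
  hr : 0 ≤ r
  hα : 2 ≤ α
  hγ : 0 < γ
  hLf : 0 < Lf
  hprob : IsProbabilityMeasure μ
  hexpmom : ∫⁻ x, ENNReal.ofReal (Real.exp (γ * sumNorm x ^ α)) ∂μ < ⊤
  hLip : κ.Lip L
  hgrow : ∃ c : ℝ, 0 < c ∧ κ.Growth c r
  hfLip : κ.fLip Lf
  hulam : ∃ M : ℝ≥0∞, M ≠ ⊤ ∧ ∀ (t : ℕ) (ht : t < T), 1 ≤ t → ∀ a,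
    ExpM α γ (κ.lam t ht a) ≤ M

end AWPaper

namespace AWPaper

lemma rpow_tsum_le_tsum_rpow (f : ℕ → ℝ≥0∞) {p : ℝ} (hp : 0 < p) (hp1 : p ≤ 1) :
    (∑' j, f j) ^ p ≤ ∑' j, f j ^ p := by
  rw [← ENNReal.le_rpow_inv_iff hp]
  refine ENNReal.tsum_le_of_sum_range_le fun n => ?_
  rw [ENNReal.le_rpow_inv_iff hp]
  refine le_trans ?_ (ENNReal.sum_le_tsum (Finset.range n))
  induction n with
  | zero => simp [hp]
  | succ n ih =>
    rw [Finset.sum_range_succ, Finset.sum_range_succ]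
    exact (ENNReal.rpow_add_le_add_rpow _ _ hp.le hp1).trans (by gcongr)

lemma sum_rpow_le_card_rpow_mul {ι : Type*} (s : Finset ι) (f : ι → ℝ≥0∞) {a : ℝ}
    (ha : a ∈ Set.Ico (0 : ℝ) 1) :
    ∑ i ∈ s, f i ^ (1 - a) ≤ (s.card : ℝ≥0∞) ^ a * (∑ i ∈ s, f i) ^ (1 - a) := by
  have h1 : 0 < 1 - a := by linarith [ha.2]
  have hp : 1 ≤ (1 - a)⁻¹ := (one_le_inv₀ h1).2 (by linarith [ha.1])
  have h := ENNReal.rpow_sum_le_const_mul_sum_rpow s (fun i => f i ^ (1 - a)) hp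
  simp only [← ENNReal.rpow_mul, mul_inv_cancel₀ h1.ne', ENNReal.rpow_one] at h
  rw [ENNReal.rpow_inv_le_iff h1, ENNReal.mul_rpow_of_nonneg _ _ h1.le, ← ENNReal.rpow_mul] at h
  convert h using 3
  field_simp
  ring

/-- Weighted Hölder estimate for the masses of finitely many disjoint pieces of a set. -/
lemma tsum_weight_mul_rpow_measure_le {Ω ι : Type*} [MeasurableSpace Ω] (μ : Measure Ω)
    (G : ι → Set Ω) (hG : ∀ z, MeasurableSet (G z)) (hdisj : Pairwise (Function.onFun Disjoint G))
    (A : Set Ω) (S : Finset ι) (hS : ∀ z, (G z ∩ A).Nonempty → z ∈ S)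
    (w : ι → ℝ≥0∞) (W : ℝ≥0∞) (hw : ∀ z, (G z ∩ A).Nonempty → w z ≤ W)
    {a : ℝ} (ha : a ∈ Set.Ico (0 : ℝ) 1) :
    ∑' z, w z * μ (G z ∩ A) ^ (1 - a) ≤ W * (S.card : ℝ≥0∞) ^ a * μ A ^ (1 - a) := by
  have h1 : 0 < 1 - a := by linarith [ha.2]
  have hle : ∀ z, w z * μ (G z ∩ A) ^ (1 - a) ≤ W * μ (G z ∩ A) ^ (1 - a) := by
    intro z
    rcases (G z ∩ A).eq_empty_or_nonempty with h | h
    · simp [h, h1]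
    · gcongr
      exact hw z h
  have hsum : ∑ z ∈ S, μ (G z ∩ A) ≤ μ A := by
    calc ∑ z ∈ S, μ (G z ∩ A) = ∑ z ∈ S, μ.restrict A (G z) := by
          simp only [Measure.restrict_apply (hG _)]
      _ ≤ μ.restrict A univ :=
          sum_measure_le_measure_univ (fun z _ => (hG z).nullMeasurableSet)
            (fun x _ y _ hxy => (hdisj hxy).aedisjoint)
      _ = μ A := Measure.restrict_apply_univ A
  calc ∑' z, w z * μ (G z ∩ A) ^ (1 - a) ≤ ∑' z, W * μ (G z ∩ A) ^ (1 - a) :=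
        ENNReal.tsum_le_tsum hle
    _ = W * ∑ z ∈ S, μ (G z ∩ A) ^ (1 - a) := by
        rw [ENNReal.tsum_mul_left, tsum_eq_sum]
        intro z hz
        rw [Set.not_nonempty_iff_eq_empty.1 fun h => hz (hS z h), measure_empty,
          ENNReal.zero_rpow_of_pos h1]
    _ ≤ W * ((S.card : ℝ≥0∞) ^ a * (∑ z ∈ S, μ (G z ∩ A)) ^ (1 - a)) := by
        gcongr
        exact sum_rpow_le_card_rpow_mul S _ ha
    _ ≤ W * ((S.card : ℝ≥0∞) ^ a * μ A ^ (1 - a)) := by gcongr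
    _ = _ := by rw [mul_assoc]

/-- The cube with index `z` of the grid of side length `1/ℓ`. -/
def gridCell (d t : ℕ) (ℓ : ℝ) (z : Idx d t) : Set (PathT d t) :=
  {a | ∀ s i, ⌊a s i * ℓ⌋ = z s i}

lemma measurableSet_gridCell (d t : ℕ) (ℓ : ℝ) (z : Idx d t) :
    MeasurableSet (gridCell d t ℓ z) := by
  have : gridCell d t ℓ z = ⋂ s, ⋂ i, {a : PathT d t | ⌊a s i * ℓ⌋ = z s i} := by
    ext; simp [gridCell]
  rw [this]
  refine MeasurableSet.iInter fun s => MeasurableSet.iInter fun i => ?_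
  have hm : Measurable fun a : PathT d t => ⌊a s i * ℓ⌋ := by
    refine Int.measurable_floor.comp (Measurable.mul_const ?_ _)
    exact (by fun_prop : Continuous fun a : PathT d t => a s i).measurable
  exact hm (measurableSet_singleton (z s i))

lemma pairwise_disjoint_gridCell (d t : ℕ) (ℓ : ℝ) :
    Pairwise (Function.onFun Disjoint (gridCell d t ℓ)) := by
  intro z z' h
  refine Set.disjoint_left.2 fun a ha ha' => h ?_
  funext s i
  rw [← ha s i, ha' s i]

lemma measurable_restr (d T : ℕ) {t : ℕ} (h : t ≤ T) : Measurable (restr d T h) :=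
  measurable_pi_lambda _ fun _ => measurable_pi_apply _

lemma abs_coord_le_of_mem_ringSet {d t j : ℕ} {x : PathT d t} (hx : x ∈ ringSet d t j)
    (s : Fin t) (i : Fin d) : |x s i| ≤ 2 ^ j := by
  have h : supA x ≤ 2 ^ ringIdx x := Nat.find_spec (ringIdx_ex x)
  rw [show ringIdx x = j from hx] at h
  have h' : ‖x s i‖₊ ≤ 2 ^ j :=
    (Finset.le_sup (f := fun p : Fin t × Fin d => ‖x p.1 p.2‖₊) (Finset.mem_univ (s, i))).trans h
  simpa using NNReal.coe_le_coe.2 h'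

lemma norm_le_of_abs_coord_le {d : ℕ} (v : E d) {M : ℝ} (h : ∀ i, |v i| ≤ M) :
    ‖v‖ ≤ d * M := by
  have hM : 0 ≤ d * M := by
    rcases Nat.eq_zero_or_pos d with rfl | hd
    · simp
    · exact mul_nonneg (by positivity) ((abs_nonneg _).trans (h ⟨0, hd⟩))
  rw [EuclideanSpace.norm_eq]
  refine Real.sqrt_le_iff.2 ⟨hM, ?_⟩
  calc ∑ i, ‖v i‖ ^ 2 ≤ ∑ _i : Fin d, M ^ 2 := by
        gcongr with i
        exact h i
    _ = d * M ^ 2 := by simp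
    _ ≤ (d * M) ^ 2 := by
        rw [mul_pow]
        gcongr
        exact_mod_cast Nat.le_self_pow two_ne_zero d

lemma sum_nnnorm_le_of_abs_coord_le {d t : ℕ} (v : PathT d t) {M : ℝ≥0}
    (h : ∀ s i, |v s i| ≤ M) : ∑ s, (‖v s‖₊ : ℝ≥0∞) ≤ (d * t : ℕ) * M := by
  have h1 : ∀ s, ‖v s‖₊ ≤ d * M := fun s => norm_le_of_abs_coord_le (v s) (h s)
  calc ∑ s, (‖v s‖₊ : ℝ≥0∞) ≤ ∑ _s : Fin t, ((d * M : ℝ≥0) : ℝ≥0∞) := by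
        gcongr with s
        exact h1 s
    _ = (d * t : ℕ) * M := by
        simp
        ring

lemma abs_sub_le_of_mem_gridCell {d t : ℕ} {ℓ : ℝ} (hℓ : 0 < ℓ) {z : Idx d t}
    {x y : PathT d t} (hx : x ∈ gridCell d t ℓ z) (hy : y ∈ gridCell d t ℓ z)
    (s : Fin t) (i : Fin d) : |x s i - y s i| ≤ ℓ⁻¹ := by
  have h := Int.abs_sub_lt_one_of_floor_eq_floor ((hx s i).trans (hy s i).symm)
  rw [← sub_mul, abs_mul, abs_of_pos hℓ] at h
  rw [← one_div, le_div_iff₀ hℓ]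
  exact h.le

lemma cellDiam_le_of_subset_gridCell {d t : ℕ} {ℓ : ℝ} (hℓ : 0 < ℓ) {z : Idx d t}
    {G : Set (PathT d t)} (hG : G ⊆ gridCell d t ℓ z) {δ : ℝ≥0} (hδ : ℓ⁻¹ ≤ δ) :
    cellDiam G ≤ (d * t : ℕ) * δ := by
  refine iSup₂_le fun x hx => iSup₂_le fun y hy => ?_
  simp only [edist_eq_enorm_sub]
  exact sum_nnnorm_le_of_abs_coord_le (x - y) fun s i =>
    (abs_sub_le_of_mem_gridCell hℓ (hG hx) (hG hy) s i).trans hδ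

lemma cellNorm_le_of_abs_coord_le {d t : ℕ} {G : Set (PathT d t)} {M : ℝ≥0}
    (h : ∀ x ∈ G, ∀ s i, |x s i| ≤ M) : cellNorm G ≤ (d * t : ℕ) * M :=
  iSup₂_le fun x hx => sum_nnnorm_le_of_abs_coord_le x (h x hx)

/-- Cells of a grid meeting a ring: weighted sum of the masses inside the ring. -/
lemma tsum_weight_mul_cellMass_inter_ringSet_le {d T t : ℕ} (μ : Measure (PathT d T))
    (h : t ≤ T) {ℓ : ℝ} (hℓ : 0 < ℓ) (j : ℕ) {n : ℕ} (hn : 1 ≤ n) (hnj : 2 ^ j * ℓ ≤ n)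
    (w : Idx d t → ℝ≥0∞) (W : ℝ≥0∞)
    (hw : ∀ z, (gridCell d t ℓ z ∩ ringSet d t j).Nonempty → w z ≤ W)
    {a : ℝ} (ha : a ∈ Set.Ico (0 : ℝ) 1) :
    ∑' z, w z * cellMass μ h (gridCell d t ℓ z ∩ ringSet d t j) ^ (1 - a)
      ≤ W * (3 * n : ℝ≥0∞) ^ (d * t * a : ℝ) * cellMass μ h (ringSet d t j) ^ (1 - a) := by
  let S : Finset (Idx d t) :=
    Fintype.piFinset fun _ => Fintype.piFinset fun _ => Finset.Icc (-(n : ℤ)) n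
  have hS : ∀ z, (gridCell d t ℓ z ∩ ringSet d t j).Nonempty → z ∈ S := by
    rintro z ⟨x, hx, hxj⟩
    simp only [S, Fintype.mem_piFinset, Finset.mem_Icc]
    intro s i
    rw [← hx s i]
    have habs : |x s i * ℓ| ≤ n := by
      rw [abs_mul, abs_of_pos hℓ]
      exact (mul_le_mul_of_nonneg_right (abs_coord_le_of_mem_ringSet hxj s i) hℓ.le).trans hnj
    rw [abs_le] at habs
    constructor
    · rw [Int.le_floor]
      push_cast
      exact habs.1
    · have hfl : ((⌊x s i * ℓ⌋ : ℤ) : ℝ) ≤ n := (Int.floor_le _).trans habs.2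
      exact_mod_cast hfl
  have hcard : (S.card : ℝ≥0∞) ≤ (3 * n : ℝ≥0∞) ^ (d * t) := by
    have : S.card ≤ (3 * n) ^ (d * t) := by
      simp only [S, Fintype.card_piFinset, Int.card_Icc, Finset.prod_const, Finset.card_univ,
        Fintype.card_fin, ← pow_mul]
      gcongr
      omega
    exact_mod_cast this
  have key := tsum_weight_mul_rpow_measure_le μ
    (fun z => restr d T h ⁻¹' gridCell d t ℓ z)
    (fun z => measurable_restr d T h (measurableSet_gridCell d t ℓ z))
    (fun z z' hz => (pairwise_disjoint_gridCell d t ℓ hz).preimage _)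
    (restr d T h ⁻¹' ringSet d t j) S
    (fun z ⟨x, hx⟩ => hS z ⟨_, hx⟩) w W (fun z ⟨x, hx⟩ => hw z ⟨_, hx⟩) ha
  refine key.trans ?_
  unfold cellMass
  gcongr
  calc (S.card : ℝ≥0∞) ^ a ≤ ((3 * n : ℝ≥0∞) ^ (d * t)) ^ a :=
        ENNReal.rpow_le_rpow hcard ha.1
    _ = (3 * n : ℝ≥0∞) ^ (d * t * a : ℝ) := by
        rw [← ENNReal.rpow_natCast, ← ENNReal.rpow_mul]
        push_cast
        rfl

lemma weight_le {b c r : ℝ} (hb : 0 < b) (hc : 0 < c) (hr : 0 ≤ r) {D : ℕ} (hD : 0 < D) (j : ℕ)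
    {X Y δ : ℝ≥0∞} (hX : X ≤ D * (2 * 2 ^ j)) (hδ : 1 ≤ δ) (hY : Y ≤ D * δ) :
    (X ^ r + 1) ^ b * (Y + 1) ^ c
      ≤ 2 ^ b * (2 * D) ^ (r * b) * (D + 1) ^ c * (2 ^ (j * (r * b) : ℝ) * δ ^ c) := by
  have h1 : (1 : ℝ≥0∞) ≤ 2 * D * 2 ^ j := by
    exact_mod_cast (by positivity : 0 < 2 * D * 2 ^ j)
  have hX' : X ^ r + 1 ≤ 2 * (2 * D * 2 ^ j) ^ r := by
    rw [two_mul]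
    refine add_le_add (ENNReal.rpow_le_rpow (hX.trans_eq (by ring)) hr) ?_
    simpa using ENNReal.rpow_le_rpow h1 hr
  have hY' : Y + 1 ≤ (D + 1) * δ := by
    rw [add_mul, one_mul]
    exact add_le_add hY hδ
  calc (X ^ r + 1) ^ b * (Y + 1) ^ c
      ≤ (2 * (2 * D * 2 ^ j) ^ r) ^ b * ((D + 1) * δ) ^ c := by gcongr
    _ = 2 ^ b * ((2 * D) ^ (r * b) * 2 ^ (j * (r * b) : ℝ)) * ((D + 1) ^ c * δ ^ c) := by
        rw [ENNReal.mul_rpow_of_nonneg _ _ hb.le, ENNReal.mul_rpow_of_nonneg _ _ hc.le,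
          ← ENNReal.rpow_mul, ENNReal.mul_rpow_of_nonneg _ _ (by positivity),
          ENNReal.rpow_mul _ (j : ℝ), ENNReal.rpow_natCast]
    _ = _ := by ring

lemma one_le_mOf {d T N : ℕ} (hN : 1 ≤ N) : 1 ≤ mOf d T N := by
  have : (0 : ℝ) < N := by exact_mod_cast hN
  refine Nat.one_le_iff_ne_zero.2 (Nat.ceil_pos.2 ?_).ne'
  unfold ΔN
  positivity

lemma mOf_le {d T N : ℕ} (hN : 1 ≤ N) :
    (mOf d T N : ℝ≥0∞) ≤ 2 * (N : ℝ≥0∞) ^ ((d * T : ℝ)⁻¹) := by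
  have hN' : (1 : ℝ) ≤ N := by exact_mod_cast hN
  have hx : (1 : ℝ) / ΔN d T N = (N : ℝ) ^ ((d * T : ℝ)⁻¹) := by
    rw [ΔN, neg_div, Real.rpow_neg (by positivity), one_div, inv_inv, one_div]
  have h1 : (1 : ℝ) ≤ (N : ℝ) ^ ((d * T : ℝ)⁻¹) := Real.one_le_rpow hN' (by positivity)
  have hm : (mOf d T N : ℝ) ≤ 2 * (N : ℝ) ^ ((d * T : ℝ)⁻¹) := by
    rw [mOf, hx]
    linarith [Nat.ceil_lt_add_one (zero_le_one.trans h1)]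
  have := ENNReal.ofReal_le_ofReal hm
  rwa [ENNReal.ofReal_natCast, ENNReal.ofReal_mul zero_le_two, ENNReal.ofReal_ofNat,
    ← ENNReal.ofReal_rpow_of_nonneg (by positivity) (by positivity),
    ENNReal.ofReal_natCast] at this

/-- The bound on the number of cells, in terms of `N`. -/
lemma rpow_mul_mOf_le {d T t N : ℕ} (hd : 0 < d) (hT : 0 < T) (ht : t ≤ T) (hN : 1 ≤ N)
    {a : ℝ} (ha : 0 ≤ a) :
    (6 * mOf d T N : ℝ≥0∞) ^ (d * t * a : ℝ)
      ≤ 12 ^ (d * T * a : ℝ) * (N : ℝ≥0∞) ^ ((t * a) / T : ℝ) := by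
  have hd' : (0 : ℝ) < d := by exact_mod_cast hd
  have hT' : (0 : ℝ) < T := by exact_mod_cast hT
  calc (6 * mOf d T N : ℝ≥0∞) ^ (d * t * a : ℝ)
      ≤ (12 * (N : ℝ≥0∞) ^ ((d * T : ℝ)⁻¹)) ^ (d * t * a : ℝ) := by
        refine ENNReal.rpow_le_rpow ?_ (by positivity)
        calc (6 * mOf d T N : ℝ≥0∞) ≤ 6 * (2 * (N : ℝ≥0∞) ^ ((d * T : ℝ)⁻¹)) := by
              gcongr
              exact mOf_le hN
          _ = _ := by rw [← mul_assoc]; norm_num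
    _ = 12 ^ (d * t * a : ℝ) * (N : ℝ≥0∞) ^ ((t * a) / T : ℝ) := by
        rw [ENNReal.mul_rpow_of_nonneg _ _ (by positivity), ← ENNReal.rpow_mul]
        congr 2
        field_simp
    _ ≤ _ := by
        gcongr
        norm_num

end AWPaper
open AWPaper in
/-- Lemma 4.2: deterministic estimates on weighted sums over the cubes of
the uniform and non-uniform grids in terms of the ring masses. -/
theorem common_estimate_cells
    {d T : ℕ} (hd : 0 < d) (hT : 2 ≤ T)
    (μ : Measure (PathT d T)) [IsProbabilityMeasure μ]
    (a b c r : ℝ) (ha : a ∈ Set.Ico (0 : ℝ) 1) (hb : 0 < b) (hc : 0 < c) (hr : 0 ≤ r) :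
    ∃ C : ℝ, 0 < C ∧ ∀ (t : ℕ) (ht : t < T), 1 ≤ t → ∀ N : ℕ, 1 ≤ N →
      (∑' z : Idx d t,
          (cellNorm (unifCell d t (mOf d T N) z) ^ r + 1) ^ b
            * (cellDiam (unifCell d t (mOf d T N) z) + 1) ^ c
            * cellMass μ ht.le (unifCell d t (mOf d T N) z) ^ (1 - a)
        ≤ ENNReal.ofReal C * (N : ℝ≥0∞) ^ ((t * a) / T : ℝ) *
            ∑' j : ℕ, (2 : ℝ≥0∞) ^ ((j : ℝ) * (r * b + d * t * a))
              * cellMass μ ht.le (ringSet d t j) ^ (1 - a))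
      ∧
      (∑' zp : ℕ × Idx d t,
          (cellNorm (nonUnifCell d t (mOf d T N) zp.1 zp.2) ^ r + 1) ^ b
            * (cellDiam (nonUnifCell d t (mOf d T N) zp.1 zp.2) + 1) ^ c
            * cellMass μ ht.le (nonUnifCell d t (mOf d T N) zp.1 zp.2) ^ (1 - a)
        ≤ ENNReal.ofReal C * (N : ℝ≥0∞) ^ ((t * a) / T : ℝ) *
            ∑' j : ℕ, (2 : ℝ≥0∞) ^ ((j : ℝ) * (r * b + c))
              * cellMass μ ht.le (ringSet d t j) ^ (1 - a)) := by
  set K : ℝ≥0∞ := 2 ^ b * (2 * (d * T : ℕ)) ^ (r * b) * ((d * T : ℕ) + 1) ^ c with hK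
  have ha0 : 0 ≤ a := ha.1
  have h1a : 0 < 1 - a := by linarith [ha.2]
  have hD : 0 < d * T := by positivity
  obtain ⟨C, hC0, hC⟩ : ∃ C : ℝ, 0 < C ∧ ENNReal.ofReal C = K * 12 ^ (d * T * a : ℝ) := by
    have htop : K * 12 ^ (d * T * a : ℝ) ≠ ⊤ := by
      have : (2 * (d * T : ℕ) : ℝ≥0∞) ≠ ⊤ := by finiteness
      have : ((d * T : ℕ) + 1 : ℝ≥0∞) ≠ ⊤ := by finiteness
      rw [hK]
      finiteness
    have hpos : K * 12 ^ (d * T * a : ℝ) ≠ 0 := by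
      have h0 : (0 : ℝ≥0∞) < 2 * (d * T : ℕ) := by exact_mod_cast (by positivity : 0 < 2 * (d * T))
      have h1 : (0 : ℝ≥0∞) < (d * T : ℕ) + 1 := by positivity
      refine mul_ne_zero (mul_ne_zero (mul_ne_zero ?_ ?_) ?_) ?_ <;>
        refine (ENNReal.rpow_pos ?_ ?_).ne' <;> first | assumption | positivity | finiteness
    exact ⟨_, ENNReal.toReal_pos hpos htop, ENNReal.ofReal_toReal htop⟩
  refine ⟨C, hC0, fun t ht _ N hN => ?_⟩
  have hm : 1 ≤ mOf d T N := one_le_mOf hN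
  have hm0 : (0 : ℝ) < mOf d T N := by exact_mod_cast hm
  have hdt : ((d * t : ℕ) : ℝ≥0∞) ≤ (d * T : ℕ) := by
    exact_mod_cast Nat.mul_le_mul_left d ht.le
  have hN' := rpow_mul_mOf_le hd (by omega) ht.le hN ha0
  rw [hC]
  constructor
  · have hw : ∀ (j : ℕ) (z : Idx d t),
        (gridCell d t (mOf d T N) z ∩ ringSet d t j).Nonempty →
        (cellNorm (unifCell d t (mOf d T N) z) ^ r + 1) ^ b
            * (cellDiam (unifCell d t (mOf d T N) z) + 1) ^ c
          ≤ K * 2 ^ (j * (r * b) : ℝ) := by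
      rintro j z ⟨x, hx, hxj⟩
      have hinv : ((mOf d T N : ℝ))⁻¹ ≤ 1 := inv_le_one_of_one_le₀ (by exact_mod_cast hm)
      refine (weight_le hb hc hr hD j ?_ le_rfl ?_).trans_eq (by simp [hK])
      · have := cellNorm_le_of_abs_coord_le (G := unifCell d t (mOf d T N) z) (M := 2 * 2 ^ j)
          fun y hy s i => ?_
        · push_cast at this
          refine this.trans ?_
          push_cast at hdt
          push_cast
          gcongr
        · have h1 := abs_sub_le_of_mem_gridCell hm0 hy hx s i
          have h2 := abs_coord_le_of_mem_ringSet hxj s i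
          have h3 : (1 : ℝ) ≤ 2 ^ j := one_le_pow₀ one_le_two
          have h4 := abs_sub_abs_le_abs_sub (y s i) (x s i)
          push_cast
          linarith
      · have := cellDiam_le_of_subset_gridCell (G := unifCell d t (mOf d T N) z) hm0
          Subset.rfl (δ := 1) (by simpa using hinv)
        refine this.trans ?_
        simpa using hdt
    calc _ ≤ ∑' z : Idx d t, ∑' j : ℕ,
          (cellNorm (unifCell d t (mOf d T N) z) ^ r + 1) ^ b
            * (cellDiam (unifCell d t (mOf d T N) z) + 1) ^ c
            * cellMass μ ht.le (gridCell d t (mOf d T N) z ∩ ringSet d t j) ^ (1 - a) := by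
          refine ENNReal.tsum_le_tsum fun z => ?_
          rw [ENNReal.tsum_mul_left]
          gcongr
          refine le_trans (ENNReal.rpow_le_rpow ?_ h1a.le)
            (rpow_tsum_le_tsum_rpow _ h1a (by linarith))
          refine (measure_mono fun x hx => ?_).trans (measure_iUnion_le _)
          exact Set.mem_iUnion.2 ⟨ringIdx (restr d T ht.le x), hx, rfl⟩
      _ = ∑' j : ℕ, ∑' z : Idx d t,
          (cellNorm (unifCell d t (mOf d T N) z) ^ r + 1) ^ b
            * (cellDiam (unifCell d t (mOf d T N) z) + 1) ^ c
            * cellMass μ ht.le (gridCell d t (mOf d T N) z ∩ ringSet d t j) ^ (1 - a) :=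
          ENNReal.tsum_comm
      _ ≤ ∑' j : ℕ, K * 12 ^ (d * T * a : ℝ) * (N : ℝ≥0∞) ^ ((t * a) / T : ℝ) *
            ((2 : ℝ≥0∞) ^ ((j : ℝ) * (r * b + d * t * a))
              * cellMass μ ht.le (ringSet d t j) ^ (1 - a)) := by
          refine ENNReal.tsum_le_tsum fun j => ?_
          refine (tsum_weight_mul_cellMass_inter_ringSet_le μ ht.le hm0 j
            (n := 2 ^ j * mOf d T N) (Nat.mul_pos (by positivity) hm) (by push_cast; rfl)
            _ _ (hw j) ha).trans ?_
          have hcount : (3 * (2 ^ j * mOf d T N : ℕ) : ℝ≥0∞) ^ (d * t * a : ℝ)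
              ≤ 2 ^ (j * (d * t * a) : ℝ) *
                (12 ^ (d * T * a : ℝ) * (N : ℝ≥0∞) ^ ((t * a) / T : ℝ)) := by
            refine le_trans ?_ (mul_le_mul_right hN' _)
            rw [ENNReal.rpow_mul _ (j : ℝ), ENNReal.rpow_natCast,
              ← ENNReal.mul_rpow_of_nonneg _ _ (by positivity)]
            refine ENNReal.rpow_le_rpow ?_ (by positivity)
            have : 3 * (2 ^ j * mOf d T N) ≤ 2 ^ j * (6 * mOf d T N) := by
              nlinarith [Nat.zero_le (2 ^ j * mOf d T N)]
            exact_mod_cast this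
          calc _ ≤ K * 2 ^ (j * (r * b) : ℝ) * (2 ^ (j * (d * t * a) : ℝ) *
                (12 ^ (d * T * a : ℝ) * (N : ℝ≥0∞) ^ ((t * a) / T : ℝ)))
                * cellMass μ ht.le (ringSet d t j) ^ (1 - a) := by gcongr
            _ = _ := by
              rw [mul_add (j : ℝ), ENNReal.rpow_add_of_nonneg _ _ (by positivity) (by positivity)]
              ring
      _ = _ := ENNReal.tsum_mul_left
  · rw [ENNReal.tsum_prod', ← ENNReal.tsum_mul_left]
    refine ENNReal.tsum_le_tsum fun j => ?_
    have hs : 0 < sideLen (mOf d T N) j := by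
      unfold sideLen
      positivity
    have hs1 : sideLen (mOf d T N) j * (2 * mOf d T N) = 2 ^ j := by
      rw [sideLen, zpow_sub_one₀ two_ne_zero, zpow_natCast]
      field_simp
    have hcell : ∀ z, nonUnifCell d t (mOf d T N) j z
        = gridCell d t (sideLen (mOf d T N) j)⁻¹ z ∩ ringSet d t j := by
      intro z
      ext x
      exact and_comm
    have hw : ∀ z : Idx d t,
        (gridCell d t (sideLen (mOf d T N) j)⁻¹ z ∩ ringSet d t j).Nonempty →
        (cellNorm (nonUnifCell d t (mOf d T N) j z) ^ r + 1) ^ b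
            * (cellDiam (nonUnifCell d t (mOf d T N) j z) + 1) ^ c
          ≤ K * 2 ^ (j * (r * b + c) : ℝ) := by
      intro z _
      have hside : sideLen (mOf d T N) j ≤ 2 ^ j := by
        rw [← hs1]
        have : (1 : ℝ) ≤ mOf d T N := by exact_mod_cast hm
        nlinarith
      refine (weight_le hb hc hr hD j (δ := 2 ^ j) ?_ (one_le_pow₀ one_le_two) ?_).trans_eq ?_
      · have := cellNorm_le_of_abs_coord_le (G := nonUnifCell d t (mOf d T N) j z) (M := 2 ^ j)
          fun y hy s i => by
            simpa using abs_coord_le_of_mem_ringSet (show y ∈ ringSet d t j from hy.1) s i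
        refine this.trans (mul_le_mul' hdt ?_)
        push_cast
        exact le_mul_of_one_le_left' one_le_two
      · rw [hcell]
        have := cellDiam_le_of_subset_gridCell (inv_pos.2 hs)
          (G := gridCell d t (sideLen (mOf d T N) j)⁻¹ z ∩ ringSet d t j)
          Set.inter_subset_left (δ := 2 ^ j) (by simpa using hside)
        refine this.trans (mul_le_mul' hdt ?_)
        push_cast
        rfl
      · rw [mul_add (j : ℝ), ENNReal.rpow_add_of_nonneg _ _ (by positivity) (by positivity),
          ENNReal.rpow_mul _ (j : ℝ) c, ENNReal.rpow_natCast]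
    have key := tsum_weight_mul_cellMass_inter_ringSet_le μ ht.le (inv_pos.2 hs) j
      (n := 2 * mOf d T N) (by omega)
      (by rw [← hs1]; push_cast; field_simp; rfl) _ _ hw ha
    simp only [← hcell] at key
    refine key.trans ?_
    have hcount : (3 * (2 * mOf d T N : ℕ) : ℝ≥0∞) = 6 * mOf d T N := by
      push_cast
      rw [← mul_assoc]
      norm_num
    rw [hcount]
    calc _ ≤ K * 2 ^ (j * (r * b + c) : ℝ) *
          (12 ^ (d * T * a : ℝ) * (N : ℝ≥0∞) ^ ((t * a) / T : ℝ))
          * cellMass μ ht.le (ringSet d t j) ^ (1 - a) := by gcongr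
      _ = _ := by ring
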